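/- arXiv:2106.10448 — 5 statements merged into one kernel-verified Lean document; each statement's English description precedes it below -/
import Mathlib

section
/- Let N ≥ 1 and let q ≥ 0 be an integer. The following are equivalent: (i) for every u, ū ∈ ℝ and every pair of attack vectors η, η̄ : Fin N → ℝ each having at most q nonzero entries, the condition u + η(j) = ū + η̄(j) for all j ∈ Fin N implies u = ū (i.e., the transmitted signal is reconstructible from the received data under q attacks); (ii) 2q < N. -/
/-- **Theorem 1 (reconstructibility).** For `N ≥ 1` channels and `q ≥ 0` attacks, the
transmitted scalar `u` is reconstructible from the received data under `q` attacks
(any two scenarios `u, η` and `ū, η̄` with at most `q` attacked channels producing the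
same received data must agree on the transmitted signal) if and only if `2q < N`. -/
theorem reconstructible_iff_two_q_lt_N (N q : ℕ) (hN : 1 ≤ N) :
    (∀ (u ubar : ℝ) (η ηbar : Fin N → ℝ),
        (Finset.univ.filter fun j => η j ≠ 0).card ≤ q →
        (Finset.univ.filter fun j => ηbar j ≠ 0).card ≤ q →
        (∀ j : Fin N, u + η j = ubar + ηbar j) → u = ubar)
      ↔ 2 * q < N := by
  constructor
  · intro h
    by_contra hlt
    obtain ⟨S, -, hS⟩ := Finset.exists_subset_card_eq
      (s := (Finset.univ : Finset (Fin N))) (n := min q N) (by simp)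
    have key := h 0 1 (fun j => if j ∈ S then 1 else 0) (fun j => if j ∈ S then 0 else -1)
      (by
        have e : (Finset.univ.filter fun j => (if j ∈ S then (1 : ℝ) else 0) ≠ 0) = S := by
          ext j; simp
        rw [e, hS]; exact min_le_left _ _)
      (by
        have e : (Finset.univ.filter fun j => (if j ∈ S then (0 : ℝ) else -1) ≠ 0) = Sᶜ := by
          ext j; simp
        rw [e, Finset.card_compl, hS, Fintype.card_fin]; omega)
      (by intro j; by_cases hj : j ∈ S <;> simp [hj])
    exact zero_ne_one key
  · intro hlt u ubar η ηbar h1 h2 heq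
    by_contra hne
    have hcov : (Finset.univ : Finset (Fin N)) ⊆
        (Finset.univ.filter fun j => η j ≠ 0) ∪ (Finset.univ.filter fun j => ηbar j ≠ 0) := by
      intro j _
      simp only [Finset.mem_union, Finset.mem_filter, Finset.mem_univ, true_and]
      by_contra hc
      push Not at hc
      apply hne
      have := heq j
      rw [hc.1, hc.2] at this
      simpa using this
    have hc := (Finset.card_le_card hcov).trans (Finset.card_union_le _ _)
    rw [Finset.card_univ, Fintype.card_fin] at hc
    omega
end

section
/- Let N ≥ 1 and let q be an integer with 2q < N. For every u, ū ∈ ℝ and every pair of attack vectors η, η̄ : Fin N → ℝ each having at most q nonzero entries, if u + η(j) = ū + η̄(j) for all j ∈ Fin N, then u = ū. -/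
/-- **Theorem 1, (ii) ⟹ (i).** If `2q < N`, then the transmitted scalar `u` is
reconstructible: for any two attack vectors with at most `q` nonzero entries producing
the same received data, the transmitted signals coincide. -/
theorem reconstructible_of_two_q_lt_N (N q : ℕ) (hN : 1 ≤ N) (hq : 2 * q < N)
    (u ubar : ℝ) (η ηbar : Fin N → ℝ)
    (hη : (Finset.univ.filter fun j => η j ≠ 0).card ≤ q)
    (hηbar : (Finset.univ.filter fun j => ηbar j ≠ 0).card ≤ q)
    (heq : ∀ j : Fin N, u + η j = ubar + ηbar j) :
    u = ubar := by
  by_contra hne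
  have hsub : (Finset.univ : Finset (Fin N)) ⊆
      (Finset.univ.filter fun j => η j ≠ 0) ∪ (Finset.univ.filter fun j => ηbar j ≠ 0) := by
    intro j _
    simp only [Finset.mem_union, Finset.mem_filter, Finset.mem_univ, true_and]
    by_contra hj
    push Not at hj
    have h := heq j
    rw [hj.1, hj.2] at h
    exact hne (by linarith)
  have h1 := Finset.card_le_card hsub
  have h2 := h1.trans (Finset.card_union_le _ _)
  rw [Finset.card_univ, Fintype.card_fin] at h2
  omega
end

section
/- Let N ≥ 1 and let q be an integer with 2q ≥ N. Then for every u ∈ ℝ and every ū ∈ ℝ with ū ≠ u, there exist attack vectors η, η̄ : Fin N → ℝ, each having at most q nonzero entries, such that u + η(j) = ū + η̄(j) for all j ∈ Fin N. In other words, if the number of attacked channels may reach N/2, the transmitted signal is not reconstructible from the received data. -/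
/-- **Theorem 1, ¬(ii) ⟹ ¬(i).** If `2q ≥ N`, the transmitted scalar is not
reconstructible: for every `u` and every `ubar ≠ u` there exist attack vectors
`η, ηbar`, each with at most `q` nonzero entries, making the received data coincide. -/
theorem not_reconstructible_of_two_q_ge_N (N q : ℕ) (hN : 1 ≤ N) (hq : N ≤ 2 * q)
    (u ubar : ℝ) (hne : ubar ≠ u) :
    ∃ η ηbar : Fin N → ℝ,
      (Finset.univ.filter fun j => η j ≠ 0).card ≤ q ∧
      (Finset.univ.filter fun j => ηbar j ≠ 0).card ≤ q ∧
      ∀ j : Fin N, u + η j = ubar + ηbar j := by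
  refine ⟨fun j => if j.val < q then ubar - u else 0,
    fun j => if j.val < q then 0 else u - ubar, ?_, ?_, ?_⟩
  · calc _ ≤ (Finset.range q).card := by
          apply Finset.card_le_card_of_injOn (fun j : Fin N => j.val)
          · intro j hj
            by_contra h
            simp_all
          · intro a _ b _ h
            exact Fin.ext h
      _ = q := Finset.card_range q
  · calc _ ≤ (Finset.Ico q N).card := by
          apply Finset.card_le_card_of_injOn (fun j : Fin N => j.val)
          · intro j hj
            have := j.isLt
            by_contra h
            simp_all
          · intro a _ b _ h
            exact Fin.ext h
      _ ≤ q := by rw [Nat.card_Ico]; omega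
  · intro j
    by_cases h : j.val < q <;> simp [h]
end

section
/- Let q be an integer with 0 ≤ q and 2q < N, and suppose the attack vector η : Fin N → ℝ has at most q nonzero entries. For each subset J ⊆ Fin N with card(J) = N − q, define û_J := (∑_{j ∈ J} U(j)) / (N − q) and π_J := max_{j ∈ J} |û_J − U(j)|. Let σ be any subset of Fin N with card(σ) = N − q achieving the minimum of π over all subsets of cardinality N − q (i.e., π_σ ≤ π_J for every J ⊆ Fin N with card(J) = N − q). Then the fused estimate satisfies |û_σ − u| ≤ 3‖ν‖∞. -/
/-- **Theorem 2 (fusion algorithm).** Suppose `2q < N` and at most `q` of the `N`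
channels are attacked.  For every channel subset `J` of cardinality `N − q`, let
`û J = (∑_{j ∈ J} U j)/(N − q)` be the average of the received values over `J` and
`π J = max_{j ∈ J} |û J − U j|` the largest deviation from that average.  If `σ` is a
subset of cardinality `N − q` minimizing `π` among all such subsets, then the fused
estimate `û σ` satisfies `|û σ − u| ≤ 3‖ν‖∞`. -/
theorem fusion_error_le_three_noise_bound (N q : ℕ) (hq : 2 * q < N)
    (u : ℝ) (ν η U : Fin N → ℝ)
    (hU : ∀ j, U j = u + ν j + η j)
    (hatk : (Finset.univ.filter fun j => η j ≠ 0).card ≤ q)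
    (uhat : Finset (Fin N) → ℝ)
    (huhat : ∀ J : Finset (Fin N), uhat J = (∑ j ∈ J, U j) / ((N - q : ℕ) : ℝ))
    (π : Finset (Fin N) → ℝ)
    (hπ : ∀ (J : Finset (Fin N)) (hJ : J.Nonempty),
        π J = J.sup' hJ (fun j => |uhat J - U j|))
    (σ : Finset (Fin N)) (hσ : σ.card = N - q)
    (hmin : ∀ J : Finset (Fin N), J.card = N - q → π σ ≤ π J) :
    |uhat σ - u|
      ≤ 3 * Finset.univ.sup'
          (Finset.univ_nonempty_iff.mpr
            (Fin.pos_iff_nonempty.mp (Nat.lt_of_le_of_lt (Nat.zero_le _) hq)))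
          (fun j => |ν j|) := by
  set M := Finset.univ.sup'
          (Finset.univ_nonempty_iff.mpr
            (Fin.pos_iff_nonempty.mp (Nat.lt_of_le_of_lt (Nat.zero_le _) hq)))
          (fun j => |ν j|) with hM
  have hν : ∀ j, |ν j| ≤ M := fun j =>
    Finset.le_sup' (fun j => |ν j|) (Finset.mem_univ j)
  have hsum := Finset.card_filter_add_card_filter_not
    (s := (Finset.univ : Finset (Fin N))) (fun j => η j ≠ 0)
  rw [Finset.card_univ, Fintype.card_fin] at hsum
  obtain ⟨I, hIG, hIc⟩ := Finset.exists_subset_card_eq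
    (s := Finset.univ.filter fun j => ¬ (η j ≠ 0)) (n := N - q) (by omega)
  have hη : ∀ j ∈ I, η j = 0 := by
    intro j hj
    simpa using hIG hj
  have hUI : ∀ j ∈ I, |U j - u| ≤ M := by
    intro j hj
    rw [hU j, hη j hj]
    have := hν j
    simpa using this
  have hpos : (0 : ℝ) < ((N - q : ℕ) : ℝ) := by
    have : 0 < N - q := by omega
    exact_mod_cast this
  have hIu : |uhat I - u| ≤ M := by
    have h1 : uhat I - u = (∑ j ∈ I, (U j - u)) / ((N - q : ℕ) : ℝ) := by
      rw [huhat, Finset.sum_sub_distrib, Finset.sum_const, hIc, nsmul_eq_mul]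
      field_simp
    rw [h1, abs_div, abs_of_pos hpos, div_le_iff₀ hpos]
    calc |∑ j ∈ I, (U j - u)| ≤ ∑ j ∈ I, |U j - u| := Finset.abs_sum_le_sum_abs _ _
      _ ≤ I.card • M := Finset.sum_le_card_nsmul _ _ _ hUI
      _ = M * ((N - q : ℕ) : ℝ) := by rw [hIc, nsmul_eq_mul, mul_comm]
  have hIne : I.Nonempty := Finset.card_pos.mp (by omega)
  have hσne : σ.Nonempty := Finset.card_pos.mp (by omega)
  have hπI : π I ≤ 2 * M := by
    rw [hπ I hIne]
    apply Finset.sup'_le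
    intro j hj
    have h1 := abs_le.mp hIu
    have h2 := abs_le.mp (hUI j hj)
    exact abs_le.mpr ⟨by linarith, by linarith⟩
  have hint : (σ ∩ I).Nonempty := by
    apply Finset.card_pos.mp
    have h1 := Finset.card_union_add_card_inter σ I
    have h2 := Finset.card_le_univ (σ ∪ I)
    rw [Fintype.card_fin] at h2
    omega
  obtain ⟨j, hj⟩ := hint
  rw [Finset.mem_inter] at hj
  have h3 : |uhat σ - U j| ≤ π σ := by
    rw [hπ σ hσne]
    exact Finset.le_sup' (fun j => |uhat σ - U j|) hj.1
  have h4 := abs_le.mp (h3.trans ((hmin I hIc).trans hπI))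
  have h5 := abs_le.mp (hUI j hj.2)
  exact abs_le.mpr ⟨by linarith, by linarith⟩
end

section
/- Let σ be a nonempty finite subset of the N channels, define û_σ := (∑_{j ∈ σ} U(j)) / card(σ) and π_σ := max_{j ∈ σ} |û_σ − U(j)|, and suppose j̄ ∈ σ is an attack-free channel (η(j̄) = 0). Then the estimation error satisfies |û_σ − u| ≤ π_σ + |ν(j̄)|. -/
/-- If the nonempty channel set `σ` contains an attack-free channel `jbar`, then the
estimation error of the average `û_σ = (∑_{j ∈ σ} U j)/card σ` is bounded by the
largest deviation `π_σ = max_{j ∈ σ} |û_σ − U j|` plus `|ν jbar|`: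
`|û_σ − u| ≤ π_σ + |ν jbar|`. -/
theorem fused_error_le_pi_add_noise (N : ℕ) (hN : 1 ≤ N)
    (u : ℝ) (ν η U : Fin N → ℝ)
    (hU : ∀ j, U j = u + ν j + η j)
    (σ : Finset (Fin N)) (hσ : σ.Nonempty)
    (jbar : Fin N) (hjbar : jbar ∈ σ) (hfree : η jbar = 0) :
    |(∑ j ∈ σ, U j) / (σ.card : ℝ) - u|
      ≤ σ.sup' hσ (fun j => |(∑ l ∈ σ, U l) / (σ.card : ℝ) - U j|) + |ν jbar| := by
  have h1 := Finset.le_sup' (fun j => |(∑ l ∈ σ, U l) / (σ.card : ℝ) - U j|) hjbar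
  have h2 : U jbar - u = ν jbar := by rw [hU, hfree]; ring
  have h3 := abs_sub_le ((∑ j ∈ σ, U j) / (σ.card : ℝ)) (U jbar) u
  rw [h2] at h3
  exact h3.trans (add_le_add h1 le_rfl)
end
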